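/- Let f : {−1,1}^n → ℝ, let k and u be integers with 1 ≤ u ≤ k, let U ⊆ [n] with |U| = u, set p = 1 − 1/(2u) and M = ⌈2u·ln(10k)⌉, and define λ_U[f] = Σ_{m=0}^{M} E_{(J,z)∼R_{p^m}}[ f̂_{[n]∖J→z}(U)² ]. Then (1/2)·NormInf_U^{≤k}[f] ≤ λ_U[f] ≤ 3·NormInf_U[f]. -/

import Mathlib

open Finset

noncomputable section

/-- The real sign of a Boolean bit: `true ↦ 1`, `false ↦ -1`. -/
def sgnB (b : Bool) : ℝ := if b then 1 else -1

/-- The character `χ_S(x) = ∏_{i ∈ S} x_i` on the cube `{±1}^n`. -/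
def chi {n : ℕ} (S : Finset (Fin n)) (x : Fin n → Bool) : ℝ := ∏ i ∈ S, sgnB (x i)

/-- The Fourier coefficient `f̂(S) = 2^{-n} ∑_x f(x) χ_S(x)`. -/
def fhat {n : ℕ} (f : (Fin n → Bool) → ℝ) (S : Finset (Fin n)) : ℝ :=
  (∑ x : Fin n → Bool, f x * chi S x) / 2 ^ n

/-- Expectation over a uniformly random point of the cube. -/
def expect {n : ℕ} (f : (Fin n → Bool) → ℝ) : ℝ := (∑ x : Fin n → Bool, f x) / 2 ^ n

/-- `f_{avg,T}(x) = ∑_{S ⊆ T} f̂(S) χ_S(x)`, the conditional expectation of `f` given `x_T`. -/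
def favg {n : ℕ} (f : (Fin n → Bool) → ℝ) (T : Finset (Fin n)) (x : Fin n → Bool) : ℝ :=
  ∑ S ∈ T.powerset, fhat f S * chi S x

/-- `g` is a junta on `T` if it depends only on the coordinates in `T`. -/
def IsJuntaOn {n : ℕ} (g : (Fin n → Bool) → ℝ) (T : Finset (Fin n)) : Prop :=
  ∀ x y : Fin n → Bool, (∀ i ∈ T, x i = y i) → g x = g y

/-- The restriction `f_{B→z}`, viewed as a function on the whole cube that
ignores the coordinates in `B` (they are fixed to `z`). -/
def restrictF {n : ℕ} (f : (Fin n → Bool) → ℝ) (B : Finset (Fin n)) (z : Fin n → Bool) :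
    (Fin n → Bool) → ℝ :=
  fun x => f (fun i => if i ∈ B then z i else x i)

/-- Expectation over a `δ`-random restriction `(J, z) ∼ R_δ`: `J` contains each
coordinate independently with probability `δ`, and `z` is uniform (only its values
outside `J` matter for the functionals we apply this to). -/
def Erestrict {n : ℕ} (δ : ℝ) (F : Finset (Fin n) → (Fin n → Bool) → ℝ) : ℝ :=
  ∑ J : Finset (Fin n), δ ^ J.card * (1 - δ) ^ (n - J.card) *
    ((∑ z : Fin n → Bool, F J z) / 2 ^ n)

/-- `dist(f,g) = Pr_x[f(x) ≠ g(x)]`. -/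
def distF {n : ℕ} (f g : (Fin n → Bool) → ℝ) : ℝ :=
  expect (fun x => if f x = g x then 0 else 1)
theorem chi_eq_prod {n : ℕ} (S : Finset (Fin n)) (x : Fin n → Bool) :
    chi S x = ∏ i, if i ∈ S then sgnB (x i) else 1 := by
  simp [chi, Finset.prod_ite_mem]

/-- Orthogonality of the characters. -/
theorem sum_chi_mul_chi {n : ℕ} (S T : Finset (Fin n)) :
    ∑ x : Fin n → Bool, chi S x * chi T x = if S = T then 2 ^ n else 0 := by
  have h : ∀ x : Fin n → Bool, chi S x * chi T x =
      ∏ i, ((if i ∈ S then sgnB (x i) else 1) * (if i ∈ T then sgnB (x i) else 1)) := by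
    intro x
    rw [chi_eq_prod, chi_eq_prod, Finset.prod_mul_distrib]
  simp_rw [h]
  have h2 := (Fintype.prod_sum (fun (i : Fin n) (b : Bool) =>
    (if i ∈ S then sgnB b else 1) * (if i ∈ T then sgnB b else 1))).symm
  rw [h2]
  have h3 : ∀ i : Fin n, (∑ b : Bool,
      (if i ∈ S then sgnB b else 1) * (if i ∈ T then sgnB b else 1)) =
      if (i ∈ S ↔ i ∈ T) then (2 : ℝ) else 0 := by
    intro i
    by_cases hS : i ∈ S <;> by_cases hT : i ∈ T <;> simp [hS, hT, sgnB]
    norm_num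
  simp_rw [h3]
  split_ifs with hST
  · subst hST
    simp
  · have : ∃ i, ¬ (i ∈ S ↔ i ∈ T) := by
      by_contra! hc
      exact hST (Finset.ext hc)
    obtain ⟨i, hi⟩ := this
    exact Finset.prod_eq_zero (Finset.mem_univ i) (if_neg hi)

/-- Completeness of the characters. -/
theorem sum_chi_mul_chi_apply {n : ℕ} (x y : Fin n → Bool) :
    ∑ S : Finset (Fin n), chi S x * chi S y = if x = y then 2 ^ n else 0 := by
  have h : ∀ S : Finset (Fin n), chi S x * chi S y = ∏ i ∈ S, sgnB (x i) * sgnB (y i) := by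
    intro S
    rw [chi, chi, Finset.prod_mul_distrib]
  simp_rw [h]
  rw [← Finset.powerset_univ, ← Finset.prod_one_add]
  have h3 : ∀ i : Fin n, 1 + sgnB (x i) * sgnB (y i) = if x i = y i then (2 : ℝ) else 0 := by
    intro i
    cases x i <;> cases y i <;> (simp [sgnB]; try norm_num)
  simp_rw [h3]
  split_ifs with hxy
  · subst hxy
    simp
  · obtain ⟨i, hi⟩ := Function.ne_iff.mp hxy
    exact Finset.prod_eq_zero (Finset.mem_univ i) (if_neg hi)

/-- Fourier inversion on the cube. -/
theorem sum_fhat_mul_chi {n : ℕ} (f : (Fin n → Bool) → ℝ) (x : Fin n → Bool) :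
    ∑ S : Finset (Fin n), fhat f S * chi S x = f x := by
  simp_rw [fhat, div_mul_eq_mul_div, Finset.sum_mul]
  rw [← Finset.sum_div, Finset.sum_comm]
  simp_rw [mul_assoc, ← Finset.mul_sum, sum_chi_mul_chi_apply]
  simp

theorem chi_mix {n : ℕ} (S J : Finset (Fin n)) (x z : Fin n → Bool) :
    chi S (fun i => if i ∈ Finset.univ \ J then z i else x i) =
      chi (S ∩ J) x * chi (S \ J) z := by
  simp_rw [chi_eq_prod, ← Finset.prod_mul_distrib]
  refine Finset.prod_congr rfl fun i _ => ?_
  by_cases hS : i ∈ S <;> by_cases hJ : i ∈ J <;> simp [hS, hJ]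

theorem fhat_restrictF {n : ℕ} (f : (Fin n → Bool) → ℝ) (J U : Finset (Fin n))
    (z : Fin n → Bool) :
    fhat (restrictF f (Finset.univ \ J) z) U =
      ∑ S with S ∩ J = U, fhat f S * chi (S \ J) z := by
  have h : ∀ x, restrictF f (Finset.univ \ J) z x =
      ∑ S, fhat f S * (chi (S ∩ J) x * chi (S \ J) z) := by
    intro x
    rw [restrictF, ← sum_fhat_mul_chi f]
    simp_rw [chi_mix]
  rw [fhat]
  simp_rw [h, Finset.sum_mul]
  rw [Finset.sum_comm, Finset.sum_div, Finset.sum_filter]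
  refine Finset.sum_congr rfl fun S _ => ?_
  have h2 : ∀ x, fhat f S * (chi (S ∩ J) x * chi (S \ J) z) * chi U x =
      fhat f S * chi (S \ J) z * (chi (S ∩ J) x * chi U x) := fun x => by ring
  simp_rw [h2, ← Finset.mul_sum, sum_chi_mul_chi]
  split_ifs <;> simp

/-- Averaging the squared Fourier coefficient of a restriction over the fixed coordinates. -/
theorem avg_fhat_restrictF_sq {n : ℕ} (f : (Fin n → Bool) → ℝ) (J U : Finset (Fin n)) :
    (∑ z : Fin n → Bool, fhat (restrictF f (Finset.univ \ J) z) U ^ 2) / 2 ^ n =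
      ∑ S with S ∩ J = U, fhat f S ^ 2 := by
  simp_rw [fhat_restrictF, sq, Finset.sum_mul_sum]
  rw [Finset.sum_comm, Finset.sum_div]
  refine Finset.sum_congr rfl fun S hS => ?_
  rw [Finset.sum_comm]
  have h2 : ∀ T z, fhat f S * chi (S \ J) z * (fhat f T * chi (T \ J) z) =
      fhat f S * fhat f T * (chi (S \ J) z * chi (T \ J) z) := fun T z => by ring
  simp_rw [h2, ← Finset.mul_sum, sum_chi_mul_chi]
  rw [Finset.sum_eq_single S]
  · simp
  · intro T hT hTS
    rw [if_neg, mul_zero]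
    intro hd
    apply hTS
    rw [Finset.mem_filter] at hS hT
    rw [← Finset.sdiff_union_inter T J, ← Finset.sdiff_union_inter S J, hd, hS.2, hT.2]
  · exact fun h => absurd hS h

/-- The probability that a `δ`-random set meets `S` exactly in `U ⊆ S`. -/
theorem sum_weight_inter_eq {n : ℕ} (δ : ℝ) {S U : Finset (Fin n)} (hUS : U ⊆ S) :
    ∑ J : Finset (Fin n), (if S ∩ J = U then δ ^ J.card * (1 - δ) ^ (n - J.card) else 0) =
      δ ^ U.card * (1 - δ) ^ (S.card - U.card) := by
  have key := Finset.prod_add (fun i : Fin n => if i ∈ S \ U then (0 : ℝ) else δ)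
    (fun i : Fin n => if i ∈ U then (0 : ℝ) else 1 - δ) Finset.univ
  rw [Finset.powerset_univ] at key
  have hL : ∏ i : Fin n, ((if i ∈ S \ U then (0 : ℝ) else δ) + (if i ∈ U then 0 else 1 - δ)) =
      δ ^ U.card * (1 - δ) ^ (S.card - U.card) := by
    have : ∀ i : Fin n, (if i ∈ S \ U then (0 : ℝ) else δ) + (if i ∈ U then 0 else 1 - δ) =
        (if i ∈ U then δ else 1) * (if i ∈ S \ U then 1 - δ else 1) := by
      intro i
      by_cases h1 : i ∈ U <;> by_cases h2 : i ∈ S <;> simp [h1, h2]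
    simp_rw [this]
    rw [Finset.prod_mul_distrib, Finset.prod_ite_mem, Finset.prod_ite_mem, Finset.univ_inter,
      Finset.univ_inter, Finset.prod_const, Finset.prod_const, Finset.card_sdiff_of_subset hUS]
  rw [← hL, key]
  refine Finset.sum_congr rfl fun J _ => ?_
  split_ifs with h
  · have h1 : ∏ i ∈ J, (if i ∈ S \ U then (0 : ℝ) else δ) = δ ^ J.card := by
      refine Finset.prod_eq_pow_card fun i hi => if_neg ?_
      rw [← h]
      simp [hi]
    have h2 : ∏ i ∈ Finset.univ \ J, (if i ∈ U then (0 : ℝ) else 1 - δ) =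
        (1 - δ) ^ (n - J.card) := by
      rw [Finset.prod_eq_pow_card (b := 1 - δ), ← Finset.compl_eq_univ_sdiff, Finset.card_compl,
        Fintype.card_fin]
      intro i hi
      refine if_neg ?_
      rw [← h, Finset.mem_inter]
      exact fun hc => (Finset.mem_sdiff.1 hi).2 hc.2
    rw [h1, h2]
  · symm
    by_cases h1 : ∃ i ∈ J, i ∈ S \ U
    · obtain ⟨i, hi, hi2⟩ := h1
      have h0 : ∏ i ∈ J, (if i ∈ S \ U then (0 : ℝ) else δ) = 0 :=
        Finset.prod_eq_zero hi (if_pos hi2)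
      rw [h0, zero_mul]
    · have h2 : ∃ i, i ∈ U ∧ i ∉ J := by
        by_contra! h2
        push Not at h1
        apply h
        ext i
        have := h1 i
        have := h2 i
        have := @hUS i
        simp at *
        tauto
      obtain ⟨i, hi, hi2⟩ := h2
      exact mul_eq_zero_of_right _ (Finset.prod_eq_zero (i := i) (by simpa using hi2) (if_pos hi))

theorem Erestrict_fhat_sq {n : ℕ} (δ : ℝ) (f : (Fin n → Bool) → ℝ) (U : Finset (Fin n)) :
    Erestrict δ (fun J z => fhat (restrictF f (Finset.univ \ J) z) U ^ 2) =
      ∑ S with U ⊆ S, fhat f S ^ 2 * (δ ^ U.card * (1 - δ) ^ (S.card - U.card)) := by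
  simp_rw [Erestrict, avg_fhat_restrictF_sq, Finset.sum_filter, Finset.mul_sum]
  rw [Finset.sum_comm]
  refine Finset.sum_congr rfl fun S _ => ?_
  split_ifs with hUS
  · rw [← sum_weight_inter_eq δ hUS, Finset.mul_sum]
    refine Finset.sum_congr rfl fun J _ => ?_
    split_ifs <;> ring
  · refine Finset.sum_eq_zero fun J _ => ?_
    rw [if_neg, mul_zero]
    rintro rfl
    exact hUS Finset.inter_subset_left

/-- The beta integral at natural parameters. -/
theorem integral_pow_mul_one_sub_pow (a b : ℕ) :
    (∫ t in (0 : ℝ)..1, t ^ a * (1 - t) ^ b) * ((a + 1) * ((a + b + 1).choose (a + 1) : ℝ)) = 1 := by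
  induction b generalizing a with
  | zero =>
    have : (a : ℝ) + 1 ≠ 0 := by positivity
    simp [this]
  | succ b ih =>
    have hd : ∀ t : ℝ, HasDerivAt (fun t : ℝ => t ^ (a + 1) * (1 - t) ^ (b + 1))
        ((a + 1) * (t ^ a * (1 - t) ^ (b + 1)) - (b + 1) * (t ^ (a + 1) * (1 - t) ^ b)) t := by
      intro t
      have h1 := hasDerivAt_pow (a + 1) t
      have h2 := ((hasDerivAt_id t).const_sub 1).fun_pow (b + 1)
      refine (h1.mul h2).congr_deriv ?_
      simp
      ring
    have hI := intervalIntegral.integral_eq_sub_of_hasDerivAt (a := 0) (b := 1)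
      (fun t _ => hd t) (Continuous.intervalIntegrable (by fun_prop) _ _)
    rw [intervalIntegral.integral_sub (Continuous.intervalIntegrable (by fun_prop) _ _)
      (Continuous.intervalIntegrable (by fun_prop) _ _), intervalIntegral.integral_const_mul,
      intervalIntegral.integral_const_mul] at hI
    simp at hI
    have h2 := ih (a + 1)
    have hc := Nat.choose_succ_right_eq (a + 1 + b + 1) (a + 1)
    have hs : a + 1 + b + 1 - (a + 1) = b + 1 := by omega
    rw [hs] at hc
    have hc' : ((a + 1 + b + 1).choose (a + 1 + 1) : ℝ) * (a + 1 + 1) =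
        ((a + 1 + b + 1).choose (a + 1) : ℝ) * (b + 1) := by exact_mod_cast hc
    have hs2 : a + (b + 1) + 1 = a + 1 + b + 1 := by omega
    rw [hs2]
    push_cast at h2
    linear_combination h2 + ((a + 1 + b + 1).choose (a + 1) : ℝ) * hI
      - (∫ t in (0 : ℝ)..1, t ^ (a + 1) * (1 - t) ^ b) * hc'

theorem intervalIntegrable_pow_mul_one_sub_pow (a b : ℕ) (x y : ℝ) :
    IntervalIntegrable (fun t : ℝ => t ^ a * (1 - t) ^ b) MeasureTheory.volume x y :=
  Continuous.intervalIntegrable (by fun_prop) _ _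

/-- Comparison with the values of `(1 - t) ^ b` at the end points. -/
theorem integral_pow_mul_one_sub_pow_bounds (a b : ℕ) {x y : ℝ} (hx : 0 ≤ x) (hxy : x ≤ y)
    (hy : y ≤ 1) :
    (y ^ (a + 1) - x ^ (a + 1)) * (1 - y) ^ b ≤ (a + 1) * ∫ t in x..y, t ^ a * (1 - t) ^ b ∧
    (a + 1) * ∫ t in x..y, t ^ a * (1 - t) ^ b ≤ (y ^ (a + 1) - x ^ (a + 1)) * (1 - x) ^ b := by
  have ha : (a : ℝ) + 1 ≠ 0 := by positivity
  have hc : ∀ c : ℝ, (a + 1) * ∫ t in x..y, t ^ a * c = (y ^ (a + 1) - x ^ (a + 1)) * c := by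
    intro c
    rw [intervalIntegral.integral_mul_const, integral_pow]
    field_simp
  rw [← hc, ← hc]
  constructor <;> refine mul_le_mul_of_nonneg_left ?_ (by positivity) <;>
    refine intervalIntegral.integral_mono_on hxy
      (Continuous.intervalIntegrable (by fun_prop) _ _)
      (Continuous.intervalIntegrable (by fun_prop) _ _) fun t ht => ?_ <;>
    obtain ⟨h1, h2⟩ := ht
  · exact mul_le_mul_of_nonneg_left (pow_le_pow_left₀ (by linarith) (by linarith) _)
      (pow_nonneg (by linarith) _)
  · exact mul_le_mul_of_nonneg_left (pow_le_pow_left₀ (by linarith) (by linarith) _)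
      (pow_nonneg (by linarith) _)

theorem sum_integral_geometric (a b : ℕ) (p : ℝ) (N : ℕ) :
    ∑ m ∈ Finset.range N, ∫ t in (p ^ (m + 1))..(p ^ m), t ^ a * (1 - t) ^ b =
      ∫ t in (p ^ N)..1, t ^ a * (1 - t) ^ b := by
  induction N with
  | zero => simp
  | succ N ih =>
    rw [Finset.sum_range_succ, ih, add_comm,
      intervalIntegral.integral_add_adjacent_intervals
        (intervalIntegrable_pow_mul_one_sub_pow a b _ _)
        (intervalIntegrable_pow_mul_one_sub_pow a b _ _)]

theorem sum_geometric_weight_le (a b N : ℕ) {p : ℝ} (hp0 : 0 ≤ p) (hp1 : p ≤ 1)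
    (hp : p ^ (a + 1) ≤ 2 / 3) :
    ∑ m ∈ Finset.range N, (p ^ m) ^ (a + 1) * (1 - p ^ m) ^ b ≤
      3 / ((a + b + 1).choose (a + 1) : ℝ) := by
  have hpos : (0 : ℝ) < ((a + b + 1).choose (a + 1) : ℝ) := by
    exact_mod_cast Nat.choose_pos (by omega)
  have hterm : ∀ m ∈ Finset.range N, (p ^ m) ^ (a + 1) * (1 - p ^ m) ^ b ≤
      3 * ((a + 1) * ∫ t in (p ^ (m + 1))..(p ^ m), t ^ a * (1 - t) ^ b) := by
    intro m _
    have h1 := (integral_pow_mul_one_sub_pow_bounds a b (pow_nonneg hp0 (m + 1))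
      (pow_le_pow_of_le_one hp0 hp1 (Nat.le_succ m)) (pow_le_one₀ hp0 hp1)).1
    have h2 : (p ^ (m + 1)) ^ (a + 1) = (p ^ m) ^ (a + 1) * p ^ (a + 1) := by
      rw [pow_succ p m, mul_pow]
    have h3 : 0 ≤ (p ^ m) ^ (a + 1) * (1 - p ^ m) ^ b :=
      mul_nonneg (by positivity) (pow_nonneg (sub_nonneg.2 (pow_le_one₀ hp0 hp1)) _)
    rw [h2] at h1
    nlinarith [mul_nonneg h3 (sub_nonneg.2 hp)]
  refine (Finset.sum_le_sum hterm).trans ?_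
  rw [← Finset.mul_sum, ← Finset.mul_sum, sum_integral_geometric, le_div_iff₀ hpos]
  have hB := integral_pow_mul_one_sub_pow a b
  have hsplit := intervalIntegral.integral_add_adjacent_intervals
    (intervalIntegrable_pow_mul_one_sub_pow a b 0 (p ^ N))
    (intervalIntegrable_pow_mul_one_sub_pow a b (p ^ N) 1)
  have hnn : 0 ≤ ∫ t in (0 : ℝ)..(p ^ N), t ^ a * (1 - t) ^ b := by
    refine intervalIntegral.integral_nonneg (pow_nonneg hp0 _) fun t ht => ?_
    have := pow_le_one₀ (n := N) hp0 hp1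
    exact mul_nonneg (pow_nonneg ht.1 _) (pow_nonneg (by linarith [ht.2]) _)
  rw [← hsplit] at hB
  have : 0 ≤ (∫ t in (0 : ℝ)..(p ^ N), t ^ a * (1 - t) ^ b) *
    ((a + 1) * ((a + b + 1).choose (a + 1) : ℝ)) := by positivity
  linarith

theorem le_sum_geometric_weight (a b N : ℕ) {p : ℝ} (hp0 : 0 ≤ p) (hp1 : p ≤ 1)
    (hp : 1 / 2 ≤ p ^ (a + 1))
    (hN : (p ^ N) ^ (a + 1) * ((a + b + 1).choose (a + 1) : ℝ) ≤ 1 / 2) :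
    1 / 2 / ((a + b + 1).choose (a + 1) : ℝ) ≤
      ∑ m ∈ Finset.range (N + 1), (p ^ m) ^ (a + 1) * (1 - p ^ m) ^ b := by
  have hpos : (0 : ℝ) < ((a + b + 1).choose (a + 1) : ℝ) := by
    exact_mod_cast Nat.choose_pos (by omega)
  have hnn : ∀ m, 0 ≤ (p ^ m) ^ (a + 1) * (1 - p ^ m) ^ b := fun m =>
    mul_nonneg (by positivity) (pow_nonneg (sub_nonneg.2 (pow_le_one₀ hp0 hp1)) _)
  have hterm : ∀ m ∈ Finset.range N,
      (a + 1) * ∫ t in (p ^ (m + 1))..(p ^ m), t ^ a * (1 - t) ^ b ≤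
      (p ^ (m + 1)) ^ (a + 1) * (1 - p ^ (m + 1)) ^ b := by
    intro m _
    refine (integral_pow_mul_one_sub_pow_bounds a b (pow_nonneg hp0 (m + 1))
      (pow_le_pow_of_le_one hp0 hp1 (Nat.le_succ m)) (pow_le_one₀ hp0 hp1)).2.trans ?_
    refine mul_le_mul_of_nonneg_right ?_
      (pow_nonneg (sub_nonneg.2 (pow_le_one₀ hp0 hp1)) _)
    have h2 : (p ^ (m + 1)) ^ (a + 1) = (p ^ m) ^ (a + 1) * p ^ (a + 1) := by
      rw [pow_succ p m, mul_pow]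
    have h3 : 0 ≤ (p ^ m) ^ (a + 1) := by positivity
    rw [h2]
    nlinarith [mul_nonneg h3 (sub_nonneg.2 hp)]
  have hsum := Finset.sum_le_sum hterm
  rw [← Finset.mul_sum, sum_integral_geometric] at hsum
  rw [Finset.sum_range_succ', div_le_iff₀ hpos]
  have hB := integral_pow_mul_one_sub_pow a b
  have hsplit := intervalIntegral.integral_add_adjacent_intervals
    (intervalIntegrable_pow_mul_one_sub_pow a b 0 (p ^ N))
    (intervalIntegrable_pow_mul_one_sub_pow a b (p ^ N) 1)
  have htail := (integral_pow_mul_one_sub_pow_bounds a b le_rfl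
    (pow_nonneg hp0 N) (pow_le_one₀ hp0 hp1)).2
  simp only [ne_eq, Nat.add_eq_zero_iff, one_ne_zero, and_false, not_false_eq_true, zero_pow,
    sub_zero, one_pow, mul_one] at htail
  rw [← hsplit] at hB
  have h0 := hnn 0
  nlinarith [mul_le_mul_of_nonneg_right htail hpos.le,
    mul_le_mul_of_nonneg_right hsum hpos.le, mul_nonneg h0 hpos.le]

/-- `λ_U[f]` is sandwiched between half the low-degree normalized
influence and three times the normalized influence of the set `U`. -/
theorem lambda_U_sandwich (n k u : ℕ) (hu : 1 ≤ u) (huk : u ≤ k)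
    (f : (Fin n → Bool) → ℝ) (U : Finset (Fin n)) (hU : U.card = u) :
    (1 / 2) * (∑ S ∈ Finset.univ.filter
          (fun S : Finset (Fin n) => U ⊆ S ∧ S.card ≤ k),
        fhat f S ^ 2 / (S.card.choose U.card : ℝ))
      ≤ (∑ m ∈ Finset.range (⌈(2 * u : ℝ) * Real.log (10 * k)⌉₊ + 1),
          Erestrict ((1 - 1 / (2 * u : ℝ)) ^ m)
            (fun J z => fhat (restrictF f (Finset.univ \ J) z) U ^ 2)) ∧
    (∑ m ∈ Finset.range (⌈(2 * u : ℝ) * Real.log (10 * k)⌉₊ + 1),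
        Erestrict ((1 - 1 / (2 * u : ℝ)) ^ m)
          (fun J z => fhat (restrictF f (Finset.univ \ J) z) U ^ 2))
      ≤ 3 * ∑ S ∈ Finset.univ.filter (fun S : Finset (Fin n) => U ⊆ S),
          fhat f S ^ 2 / (S.card.choose U.card : ℝ) := by
  have hu' : (1 : ℝ) ≤ u := by exact_mod_cast hu
  have hku : (u : ℝ) ≤ k := by exact_mod_cast huk
  set p : ℝ := 1 - 1 / (2 * u : ℝ) with hpdef
  set N : ℕ := ⌈(2 * u : ℝ) * Real.log (10 * k)⌉₊ with hNdef
  have hq : 1 / (2 * u : ℝ) ≤ 1 / 2 := by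
    rw [div_le_div_iff₀ (by positivity) (by norm_num)]
    linarith
  have hq0 : 0 ≤ 1 / (2 * u : ℝ) := by positivity
  have hp0 : 0 ≤ p := by linarith
  have hp1 : p ≤ 1 := by linarith
  have hexp : p ≤ Real.exp (-(1 / (2 * u : ℝ))) := by
    have := Real.add_one_le_exp (-(1 / (2 * u : ℝ)))
    linarith
  have hpu : p ^ u ≤ 2 / 3 := by
    have h1 : p ^ u ≤ Real.exp (-(1 / 2)) := by
      refine (pow_le_pow_left₀ hp0 hexp u).trans_eq ?_
      rw [← Real.exp_nat_mul]
      congr 1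
      field_simp
    have h2 := Real.add_one_le_exp (1 / 2 : ℝ)
    have h3 : Real.exp (-(1 / 2)) * Real.exp (1 / 2) = 1 := by
      rw [← Real.exp_add]
      simp
    nlinarith [Real.exp_pos (-(1 / 2) : ℝ)]
  have hpl : 1 / 2 ≤ p ^ u := by
    have h1 := one_add_mul_le_pow (a := -(1 / (2 * u : ℝ))) (by linarith) u
    have h2 : 1 + (u : ℝ) * -(1 / (2 * u : ℝ)) = 1 / 2 := by
      field_simp
      norm_num
    rw [h2] at h1
    rwa [hpdef, sub_eq_add_neg]
  have hpN : p ^ N ≤ 1 / (10 * k) := by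
    have hk : (0 : ℝ) < 10 * k := by linarith
    refine (pow_le_pow_left₀ hp0 hexp N).trans ?_
    have hlog : 1 / (10 * (k : ℝ)) = Real.exp (-Real.log (10 * k)) := by
      rw [Real.exp_neg, Real.exp_log hk, one_div]
    rw [← Real.exp_nat_mul, hlog, Real.exp_le_exp]
    have hN : (2 * u : ℝ) * Real.log (10 * k) ≤ N := Nat.le_ceil _
    have : Real.log (10 * k) ≤ N * (1 / (2 * u : ℝ)) := by
      rw [mul_one_div, le_div_iff₀ (by positivity)]
      linarith
    linarith
  simp_rw [Erestrict_fhat_sq]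
  rw [Finset.sum_comm]
  simp_rw [← Finset.mul_sum]
  obtain ⟨a, rfl⟩ : ∃ a, u = a + 1 := ⟨u - 1, by omega⟩
  rw [hU]
  constructor
  · rw [Finset.mul_sum]
    refine (Finset.sum_le_sum fun S hS => ?_).trans
      (Finset.sum_le_sum_of_subset_of_nonneg
        (fun S hS => by simp at hS ⊢; exact hS.1) fun S _ _ => ?_)
    · obtain ⟨hUS, hSk⟩ := (Finset.mem_filter.1 hS).2
      have hcard := Finset.card_le_card hUS
      rw [hU] at hcard
      obtain ⟨b, hb⟩ : ∃ b, S.card = a + b + 1 := ⟨S.card - (a + 1), by omega⟩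
      have hsub : a + b + 1 - (a + 1) = b := by omega
      rw [hb, hsub]
      have hN : (p ^ N) ^ (a + 1) * ((a + b + 1).choose (a + 1) : ℝ) ≤ 1 / 2 := by
        have hch : ((a + b + 1).choose (a + 1) : ℝ) ≤ (k : ℝ) ^ (a + 1) := by
          have h1 := Nat.choose_le_pow (a + b + 1) (a + 1)
          have h2 := Nat.pow_le_pow_left (hb ▸ hSk) (a + 1)
          exact_mod_cast h1.trans h2
        have hk : (k : ℝ) ≠ 0 := by linarith
        calc (p ^ N) ^ (a + 1) * ((a + b + 1).choose (a + 1) : ℝ)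
            ≤ (1 / (10 * k)) ^ (a + 1) * (k : ℝ) ^ (a + 1) := by gcongr
          _ = (1 / 10) ^ (a + 1) := by
            rw [← mul_pow]
            congr 1
            field_simp
          _ ≤ (1 / 10) ^ 1 := pow_le_pow_of_le_one (by norm_num) (by norm_num) (by omega)
          _ ≤ 1 / 2 := by norm_num
      have h := le_sum_geometric_weight a b N hp0 hp1 hpl hN
      calc _ = fhat f S ^ 2 * (1 / 2 / ((a + b + 1).choose (a + 1) : ℝ)) := by ring
        _ ≤ _ := mul_le_mul_of_nonneg_left h (sq_nonneg _)
    · exact mul_nonneg (sq_nonneg _) (Finset.sum_nonneg fun m _ =>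
        mul_nonneg (by positivity) (pow_nonneg (sub_nonneg.2 (pow_le_one₀ hp0 hp1)) _))
  · rw [Finset.mul_sum]
    refine Finset.sum_le_sum fun S hS => ?_
    have hcard := Finset.card_le_card (Finset.mem_filter.1 hS).2
    rw [hU] at hcard
    obtain ⟨b, hb⟩ : ∃ b, S.card = a + b + 1 := ⟨S.card - (a + 1), by omega⟩
    have hsub : a + b + 1 - (a + 1) = b := by omega
    rw [hb, hsub]
    have h := sum_geometric_weight_le a b (N + 1) hp0 hp1 hpu
    calc _ ≤ fhat f S ^ 2 * (3 / ((a + b + 1).choose (a + 1) : ℝ)) :=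
          mul_le_mul_of_nonneg_left h (sq_nonneg _)
      _ = _ := by ring
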